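/- Let ℍ^+ = {ξ ∈ ℝ^{2n+1} : ⟨ξ, ν⟩ > d}, δ(ξ) = ⟨ξ, ν⟩ − d, W(ξ) = |∇_H δ(ξ)|, Q = 2n+2 the homogeneous dimension. For 2 ≤ p < Q and p* = Qp/(Q−p), there exists C > 0 such that for all u ∈ C_0^∞(ℍ^+): ( ∫_{ℍ^+} |∇_H u|^p dξ − ((p-1)/p)^p ∫_{ℍ^+} (W^p/δ^p) |u|^p dξ )^{1/p} ≥ C ( ∫_{ℍ^+} |u|^{p*} dξ )^{1/p*}. -/

import Mathlib

open MeasureTheory Real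

noncomputable section

abbrev H (n : ℕ) := (Fin n → ℝ) × (Fin n → ℝ) × ℝ

/-- Coefficient vector of the left-invariant field `X_i` at `ξ`. -/
def Xv (n : ℕ) (i : Fin n) (ξ : H n) : H n := (Pi.single i 1, 0, 2 * ξ.2.1 i)

/-- Coefficient vector of the left-invariant field `Y_i` at `ξ`. -/
def Yv (n : ℕ) (i : Fin n) (ξ : H n) : H n := (0, Pi.single i 1, -(2 * ξ.1 i))

/-- The derivative `X_i f`. -/
def XD (n : ℕ) (i : Fin n) (f : H n → ℝ) (ξ : H n) : ℝ := fderiv ℝ f ξ (Xv n i ξ)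

/-- The derivative `Y_i f`. -/
def YD (n : ℕ) (i : Fin n) (f : H n → ℝ) (ξ : H n) : ℝ := fderiv ℝ f ξ (Yv n i ξ)

/-- Euclidean norm of the horizontal gradient. -/
def hNorm (n : ℕ) (f : H n → ℝ) (ξ : H n) : ℝ :=
  Real.sqrt (∑ i, ((XD n i f ξ) ^ 2 + (YD n i f ξ) ^ 2))

/-- Euclidean inner product on `ℝ^{2n+1}`. -/
def iprod (n : ℕ) (a b : H n) : ℝ :=
  (∑ i, a.1 i * b.1 i) + (∑ i, a.2.1 i * b.2.1 i) + a.2.2 * b.2.2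

section InnerProductSpace

variable {E : Type*} [NormedAddCommGroup E] [InnerProductSpace ℝ E]

theorem norm_rpow_add_inner_le (a h : E) {p : ℝ} (hp : 1 < p) :
    ‖a‖ ^ p + p * (‖a‖ ^ (p - 2) * inner ℝ a h) ≤ ‖a + h‖ ^ p := by
  have hp0 : 0 < p := by linarith
  rcases eq_or_ne a 0 with rfl | ha
  · simp only [norm_zero, inner_zero_left, mul_zero, add_zero, zero_add]
    rw [Real.zero_rpow hp0.ne']
    positivity
  have hm : 0 < ‖a‖ := norm_pos_iff.2 ha
  have h1 : inner ℝ a h ≤ ‖a‖ * ‖a + h‖ - ‖a‖ ^ 2 := by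
    have h2 := real_inner_le_norm a (a + h)
    rw [inner_add_right, real_inner_self_eq_norm_sq] at h2
    linarith
  have hy := Real.young_inequality_of_nonneg (a := ‖a + h‖) (b := ‖a‖ ^ (p - 1))
    (norm_nonneg _) (by positivity) (Real.HolderConjugate.conjExponent hp)
  rw [← Real.rpow_mul hm.le, Real.conjExponent,
    show (p - 1) * (p / (p - 1)) = p by field_simp [show p - 1 ≠ 0 by linarith]] at hy
  have e1 : ‖a‖ ^ (p - 2) * ‖a‖ = ‖a‖ ^ (p - 1) := by
    rw [← Real.rpow_add_one hm.ne']; ring_nf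
  have e2 : ‖a‖ ^ (p - 2) * ‖a‖ ^ 2 = ‖a‖ ^ p := by
    rw [← Real.rpow_natCast, ← Real.rpow_add hm]; norm_num
  have h3 : ‖a‖ ^ (p - 2) * inner ℝ a h ≤ ‖a‖ ^ (p - 1) * ‖a + h‖ - ‖a‖ ^ p := by
    calc _ ≤ ‖a‖ ^ (p - 2) * (‖a‖ * ‖a + h‖ - ‖a‖ ^ 2) := by gcongr
      _ = _ := by rw [← e1, ← e2]; ring
  have h4 := mul_le_mul_of_nonneg_left h3 hp0.le
  have h5 := mul_le_mul_of_nonneg_left hy hp0.le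
  have e3 : p * (‖a + h‖ ^ p / p + ‖a‖ ^ p / (p / (p - 1))) =
      ‖a + h‖ ^ p + (p - 1) * ‖a‖ ^ p := by
    field_simp
  rw [e3] at h5
  nlinarith

theorem clarkson_norm_rpow (x y : E) {p : ℝ} (hp : 2 ≤ p) :
    ‖x + y‖ ^ p + ‖x - y‖ ^ p ≤ 2 ^ (p - 1) * (‖x‖ ^ p + ‖y‖ ^ p) := by
  have key : ∀ z : ℝ, 0 ≤ z → z ^ p = (z ^ 2) ^ (p / 2) := fun z hz => by
    rw [← Real.rpow_natCast, ← Real.rpow_mul hz]; congr 1; push_cast; ring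
  have hq : 1 ≤ p / 2 := by linarith
  have h1 := Real.add_rpow_le_rpow_add (sq_nonneg ‖x + y‖) (sq_nonneg ‖x - y‖) hq
  have hpar : ‖x + y‖ ^ 2 + ‖x - y‖ ^ 2 = 2 * (‖x‖ ^ 2 + ‖y‖ ^ 2) := by
    simpa using parallelogram_law_with_norm ℝ x y
  rw [hpar] at h1
  obtain ⟨-, hconv⟩ := convexOn_rpow hq
  have h2 := hconv (Set.mem_Ici.2 (sq_nonneg ‖x‖)) (Set.mem_Ici.2 (sq_nonneg ‖y‖))
    (a := 1 / 2) (b := 1 / 2) (by norm_num) (by norm_num) (by norm_num)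
  simp only [smul_eq_mul] at h2
  have h3 : (2 * (‖x‖ ^ 2 + ‖y‖ ^ 2)) ^ (p / 2)
      = 2 ^ p * (1 / 2 * ‖x‖ ^ 2 + 1 / 2 * ‖y‖ ^ 2) ^ (p / 2) := by
    rw [show 2 * (‖x‖ ^ 2 + ‖y‖ ^ 2) = 2 ^ 2 * (1 / 2 * ‖x‖ ^ 2 + 1 / 2 * ‖y‖ ^ 2) by ring,
      Real.mul_rpow (by positivity) (by positivity), ← key 2 (by norm_num)]
  rw [key ‖x + y‖ (norm_nonneg _), key ‖x - y‖ (norm_nonneg _), key ‖x‖ (norm_nonneg _),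
    key ‖y‖ (norm_nonneg _), Real.rpow_sub_one (by norm_num)]
  rw [h3] at h1
  calc _ ≤ _ := h1
    _ ≤ _ := mul_le_mul_of_nonneg_left h2 (by positivity)
    _ = _ := by ring

theorem norm_rpow_add_inner_add_le (a b : E) {p : ℝ} (hp : 2 ≤ p) :
    ‖a‖ ^ p + p * (‖a‖ ^ (p - 2) * inner ℝ a b) + 2 ^ (1 - p) * ‖b‖ ^ p ≤ ‖a + b‖ ^ p := by
  have h1 := clarkson_norm_rpow (a + b) a hp
  rw [show a + b - a = b by abel,
    show a + b + a = (2 : ℝ) • (a + (1 / 2 : ℝ) • b) by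
      rw [smul_add, smul_smul, two_smul]; norm_num; abel,
    norm_smul, Real.mul_rpow (norm_nonneg _) (norm_nonneg _)] at h1
  have h2 := norm_rpow_add_inner_le a ((1 / 2 : ℝ) • b) (p := p) (by linarith)
  rw [inner_smul_right] at h2
  have e1 : (2 : ℝ) ^ p = 2 * 2 ^ (p - 1) := by
    rw [Real.rpow_sub_one (by norm_num)]; ring
  have e2 : (2 : ℝ) ^ (1 - p) * 2 ^ (p - 1) = 1 := by
    rw [← Real.rpow_add (by norm_num)]; norm_num
  have h3 := mul_le_mul_of_nonneg_left h1 (show (0 : ℝ) ≤ 2 ^ (1 - p) by positivity)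
  have e3 : ‖(2 : ℝ)‖ = 2 := by norm_num
  rw [e3, e1] at h3
  have h4 : 2 * ‖a + (1 / 2 : ℝ) • b‖ ^ p + 2 ^ (1 - p) * ‖b‖ ^ p ≤ ‖a + b‖ ^ p + ‖a‖ ^ p := by
    calc _ = 2 * (2 ^ (1 - p) * 2 ^ (p - 1)) * ‖a + (1 / 2 : ℝ) • b‖ ^ p
          + 2 ^ (1 - p) * ‖b‖ ^ p := by rw [e2, mul_one]
      _ ≤ 2 ^ (1 - p) * (2 ^ (p - 1) * (‖a + b‖ ^ p + ‖a‖ ^ p)) := by linarith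
      _ = (2 ^ (1 - p) * 2 ^ (p - 1)) * (‖a + b‖ ^ p + ‖a‖ ^ p) := by ring
      _ = _ := by rw [e2, one_mul]
  linarith

end InnerProductSpace

section HorizontalGradient

variable {n : ℕ}

instance isAddHaarMeasure_volume_H (n : ℕ) : (volume : Measure (H n)).IsAddHaarMeasure := by
  have : (volume : Measure ((Fin n → ℝ) × ℝ)).IsAddHaarMeasure := by
    rw [Measure.volume_eq_prod]; infer_instance
  rw [Measure.volume_eq_prod]
  exact Measure.prod.instIsAddHaarMeasure _ _

/-- The horizontal frame: `X_i` at `Sum.inl i`, `Y_i` at `Sum.inr i`. -/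
def hFrame (n : ℕ) (k : Fin n ⊕ Fin n) (ξ : H n) : H n :=
  k.elim (fun i => Xv n i ξ) (fun i => Yv n i ξ)

/-- The horizontal gradient as a vector of `ℝ²ⁿ`. -/
def hGrad (n : ℕ) (f : H n → ℝ) (ξ : H n) : EuclideanSpace ℝ (Fin n ⊕ Fin n) :=
  WithLp.toLp 2 fun k => fderiv ℝ f ξ (hFrame n k ξ)

@[simp]
theorem hGrad_apply (f : H n → ℝ) (ξ : H n) (k : Fin n ⊕ Fin n) :
    hGrad n f ξ k = fderiv ℝ f ξ (hFrame n k ξ) := rfl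

theorem norm_hGrad (f : H n → ℝ) (ξ : H n) : ‖hGrad n f ξ‖ = hNorm n f ξ := by
  rw [EuclideanSpace.norm_eq, hNorm, Fintype.sum_sum_type, Finset.sum_add_distrib]
  simp [hFrame, XD, YD]

theorem hGrad_mul {f g : H n → ℝ} {ξ : H n} (hf : DifferentiableAt ℝ f ξ)
    (hg : DifferentiableAt ℝ g ξ) :
    hGrad n (fun ζ => f ζ * g ζ) ξ = f ξ • hGrad n g ξ + g ξ • hGrad n f ξ := by
  ext k
  simp [fderiv_fun_mul hf hg]

theorem hGrad_comp {φ : ℝ → ℝ} {φ' : ℝ} {f : H n → ℝ} {ξ : H n}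
    (hφ : HasDerivAt φ φ' (f ξ)) (hf : DifferentiableAt ℝ f ξ) :
    hGrad n (fun ζ => φ (f ζ)) ξ = φ' • hGrad n f ξ := by
  ext k
  have := (hφ.comp_hasFDerivAt ξ hf.hasFDerivAt).fderiv
  simp only [Function.comp_def] at this
  simp [this]

theorem continuous_hFrame (k : Fin n ⊕ Fin n) : Continuous (hFrame n k) := by
  rcases k with i | i
  · change Continuous (Xv n i)
    unfold Xv
    fun_prop
  · change Continuous (Yv n i)
    unfold Yv
    fun_prop

theorem continuous_hGrad {f : H n → ℝ} (hf : ContDiff ℝ 1 f) : Continuous (hGrad n f) := by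
  refine (PiLp.continuous_toLp 2 _).comp (continuous_pi fun k => ?_)
  exact (hf.continuous_fderiv one_ne_zero).clm_apply (continuous_hFrame k)

theorem hGrad_eq_zero {f : H n → ℝ} {ξ : H n} (h : ξ ∉ tsupport f) : hGrad n f ξ = 0 := by
  ext k
  simp [fderiv_of_notMem_tsupport ℝ h]

theorem integral_mul_fderiv_eq_zero {f g : H n → ℝ} {v : H n} (hf : ContDiff ℝ 1 f)
    (hfv : ∀ ξ, fderiv ℝ f ξ v = 0) (hg : ContDiff ℝ 1 g) (hc : HasCompactSupport g) :
    ∫ ξ, f ξ * fderiv ℝ g ξ v = 0 := by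
  have hg' : Continuous fun ξ => fderiv ℝ g ξ v :=
    (hg.continuous_fderiv one_ne_zero).clm_apply continuous_const
  rw [integral_mul_fderiv_eq_neg_fderiv_mul_of_integrable]
  · simp [hfv]
  · simp [hfv]
  · refine (hf.continuous.mul hg').integrable_of_hasCompactSupport ?_
    refine HasCompactSupport.intro hc fun ξ hξ => ?_
    simp [fderiv_of_notMem_tsupport ℝ hξ]
  · exact (hf.continuous.mul hg.continuous).integrable_of_hasCompactSupport hc.mul_left
  · exact fun ξ _ => (hf.differentiable one_ne_zero) ξ
  · exact fun ξ _ => (hg.differentiable one_ne_zero) ξ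

theorem integral_fderiv_hFrame {f : H n → ℝ} (hf : ContDiff ℝ 1 f) (hc : HasCompactSupport f)
    (k : Fin n ⊕ Fin n) : ∫ ξ, fderiv ℝ f ξ (hFrame n k ξ) = 0 := by
  have key : ∀ (v : H n) (L : H n →L[ℝ] ℝ), L (0, 0, 1) = 0 →
      ∫ ξ, fderiv ℝ f ξ (v + L ξ • ((0, 0, 1) : H n)) = 0 := by
    intro v L hL
    have i1 : ∀ v : H n, Continuous fun ξ => fderiv ℝ f ξ v := fun v =>
      (hf.continuous_fderiv one_ne_zero).clm_apply continuous_const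
    have h1 : ∫ ξ, fderiv ℝ f ξ v = 0 := by
      simpa using integral_mul_fderiv_eq_zero (f := fun _ => 1) (v := v) contDiff_const
        (by simp) hf hc
    have h2 := integral_mul_fderiv_eq_zero (f := L) (v := (0, 0, 1)) L.contDiff
      (by simp [hL]) hf hc
    simp only [map_add, map_smul, smul_eq_mul]
    rw [integral_add, h1, h2, add_zero]
    · refine (i1 v).integrable_of_hasCompactSupport ?_
      exact HasCompactSupport.intro hc fun ξ hξ => by simp [fderiv_of_notMem_tsupport ℝ hξ]
    · refine (L.continuous.mul (i1 _)).integrable_of_hasCompactSupport ?_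
      exact HasCompactSupport.intro hc fun ξ hξ => by simp [fderiv_of_notMem_tsupport ℝ hξ]
  rcases k with i | i
  · refine Eq.trans ?_ (key (Pi.single i 1, 0, 0)
      ((2 : ℝ) • (ContinuousLinearMap.proj (R := ℝ) (φ := fun _ : Fin n => ℝ) i ∘L
        ContinuousLinearMap.fst ℝ _ _ ∘L ContinuousLinearMap.snd ℝ _ _)) (by simp))
    congr! 3 with ξ
    simp [hFrame, Xv]
  · refine Eq.trans ?_ (key (0, Pi.single i 1, 0)
      ((-2 : ℝ) • (ContinuousLinearMap.proj (R := ℝ) (φ := fun _ : Fin n => ℝ) i ∘L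
        ContinuousLinearMap.fst ℝ _ _)) (by simp))
    congr! 3 with ξ
    simp [hFrame, Yv]

theorem hasFDerivAt_iprod (ν : H n) (d : ℝ) (ξ : H n) :
    ∃ L : H n →L[ℝ] ℝ, (∀ η, L η = iprod n η ν) ∧
      HasFDerivAt (fun ζ => iprod n ζ ν - d) L ξ := by
  let L : H n →ₗ[ℝ] ℝ :=
    { toFun := fun η => iprod n η ν
      map_add' := fun a b => by
        simp only [iprod, Prod.fst_add, Prod.snd_add, Pi.add_apply, add_mul,
          Finset.sum_add_distrib]; ring
      map_smul' := fun r a => by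
        simp only [iprod, Prod.smul_fst, Prod.smul_snd, Pi.smul_apply, smul_eq_mul,
          RingHom.id_apply, mul_add, Finset.mul_sum, mul_assoc] }
  exact ⟨L.toContinuousLinearMap, fun η => rfl,
    L.toContinuousLinearMap.hasFDerivAt.sub_const d⟩

theorem contDiff_iprod_sub (ν : H n) (d : ℝ) {m : WithTop ℕ∞} :
    ContDiff ℝ m fun ζ : H n => iprod n ζ ν - d := by
  unfold iprod; fun_prop

/-- The horizontal gradient of an affine function with Euclidean gradient `ν`. -/
def hNormal (ν ξ : H n) : EuclideanSpace ℝ (Fin n ⊕ Fin n) :=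
  WithLp.toLp 2 (Sum.elim (fun i => ν.1 i + 2 * ν.2.2 * ξ.2.1 i)
    (fun i => ν.2.1 i - 2 * ν.2.2 * ξ.1 i))

theorem hGrad_iprod_sub (ν : H n) (d : ℝ) (ξ : H n) :
    hGrad n (fun ζ => iprod n ζ ν - d) ξ = hNormal ν ξ := by
  obtain ⟨L, hL, h⟩ := hasFDerivAt_iprod ν d ξ
  ext k
  rw [hGrad_apply, h.fderiv, hL]
  rcases k with i | i <;>
    simp [hFrame, Xv, Yv, iprod, hNormal, Pi.single_apply] <;> ring

theorem contDiff_hNormal_apply (ν : H n) (k : Fin n ⊕ Fin n) :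
    ContDiff ℝ 1 fun ξ => hNormal ν ξ k := by
  rcases k with i | i <;> simp only [hNormal, Sum.elim_inl, Sum.elim_inr] <;> fun_prop

theorem continuous_hNormal (ν : H n) : Continuous (hNormal ν) :=
  (PiLp.continuous_toLp 2 _).comp (continuous_pi fun k => (contDiff_hNormal_apply ν k).continuous)

theorem fderiv_hNormal_inl (ν ξ v : H n) (i : Fin n) :
    fderiv ℝ (fun ζ => hNormal ν ζ (Sum.inl i)) ξ v = 2 * ν.2.2 * v.2.1 i := by
  simp only [hNormal, Sum.elim_inl]
  have : HasFDerivAt (fun ζ : H n => ν.1 i + 2 * ν.2.2 * ζ.2.1 i) ((2 * ν.2.2) •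
      (ContinuousLinearMap.proj (R := ℝ) (φ := fun _ : Fin n => ℝ) i ∘L
        ContinuousLinearMap.fst ℝ _ _ ∘L ContinuousLinearMap.snd ℝ (Fin n → ℝ) _)) ξ :=
    (ContinuousLinearMap.hasFDerivAt
      ((2 * ν.2.2) • (ContinuousLinearMap.proj (R := ℝ) (φ := fun _ : Fin n => ℝ) i ∘L
        ContinuousLinearMap.fst ℝ _ ℝ ∘L ContinuousLinearMap.snd ℝ (Fin n → ℝ) _))).const_add _
  rw [this.fderiv]
  simp

theorem fderiv_hNormal_inr (ν ξ v : H n) (i : Fin n) :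
    fderiv ℝ (fun ζ => hNormal ν ζ (Sum.inr i)) ξ v = -(2 * ν.2.2 * v.1 i) := by
  simp only [hNormal, Sum.elim_inr]
  have : HasFDerivAt (fun ζ : H n => ν.2.1 i - 2 * ν.2.2 * ζ.1 i) (-((2 * ν.2.2) •
      (ContinuousLinearMap.proj (R := ℝ) (φ := fun _ : Fin n => ℝ) i ∘L
        ContinuousLinearMap.fst ℝ _ ((Fin n → ℝ) × ℝ)))) ξ :=
    (ContinuousLinearMap.hasFDerivAt
      ((2 * ν.2.2) • (ContinuousLinearMap.proj (R := ℝ) (φ := fun _ : Fin n => ℝ) i ∘L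
        ContinuousLinearMap.fst ℝ _ ((Fin n → ℝ) × ℝ)))).const_sub _
  rw [this.fderiv]
  simp

theorem fderiv_hNormal_hFrame_self (ν ξ : H n) (k : Fin n ⊕ Fin n) :
    fderiv ℝ (fun ζ => hNormal ν ζ k) ξ (hFrame n k ξ) = 0 := by
  rcases k with i | i
  · simp [fderiv_hNormal_inl, hFrame, Xv]
  · simp [fderiv_hNormal_inr, hFrame, Yv]

theorem contDiff_norm_hNormal_sq (ν : H n) : ContDiff ℝ 1 fun ξ => ‖hNormal ν ξ‖ ^ 2 := by
  simp only [EuclideanSpace.norm_sq_eq, Real.norm_eq_abs, sq_abs]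
  exact ContDiff.sum fun k _ => (contDiff_hNormal_apply ν k).pow 2

/-- The horizontal Hessian of an affine function is skew-symmetric, so its horizontal gradient is
orthogonal to the horizontal gradient of `‖hNormal ν ·‖ ^ 2`. -/
theorem inner_hNormal_hGrad_norm_sq (ν ξ : H n) :
    inner ℝ (hNormal ν ξ) (hGrad n (fun ζ => ‖hNormal ν ζ‖ ^ 2) ξ) = 0 := by
  have hd : ∀ (v : H n), fderiv ℝ (fun ζ => ‖hNormal ν ζ‖ ^ 2) ξ v =
      ∑ k, 2 * hNormal ν ξ k * fderiv ℝ (fun ζ => hNormal ν ζ k) ξ v := by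
    intro v
    have h : HasFDerivAt (fun ζ => ‖hNormal ν ζ‖ ^ 2)
        (∑ k, (2 * hNormal ν ξ k) • fderiv ℝ (fun ζ => hNormal ν ζ k) ξ) ξ := by
      simp only [EuclideanSpace.norm_sq_eq, Real.norm_eq_abs, sq_abs]
      refine HasFDerivAt.fun_sum fun k _ => ?_
      have := (((contDiff_hNormal_apply ν k).differentiable one_ne_zero) ξ).hasFDerivAt.pow 2
      simpa using this
    rw [h.fderiv]
    simp
  simp only [PiLp.inner_apply, hGrad_apply, hd, Fintype.sum_sum_type, fderiv_hNormal_inl,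
    fderiv_hNormal_inr, hFrame, Sum.elim_inl, Sum.elim_inr, Xv, Yv]
  simp only [Pi.single_apply, Pi.zero_apply, mul_zero, neg_zero, Finset.sum_const_zero, zero_add,
    add_zero, mul_one, Finset.sum_ite_eq', Finset.mem_univ, if_true,
    RCLike.inner_apply, conj_trivial, apply_ite, neg_zero, ← Finset.sum_add_distrib]
  refine Finset.sum_eq_zero fun i _ => ?_
  simp
  ring

/-- The field `Φ(‖∇_H δ‖²) ∇_H δ` is divergence free. -/
theorem integral_mul_inner_hNormal (ν : H n) {f : H n → ℝ} (hf : ContDiff ℝ 1 f)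
    (hc : HasCompactSupport f) (r : ℝ) {ε : ℝ} (hε : ε ≠ 0) :
    ∫ ξ, (‖hNormal ν ξ‖ ^ 2 + ε ^ 2) ^ r * inner ℝ (hNormal ν ξ) (hGrad n f ξ) = 0 := by
  set Φ : H n → ℝ := fun ξ => (‖hNormal ν ξ‖ ^ 2 + ε ^ 2) ^ r
  have hpos : ∀ ξ, ‖hNormal ν ξ‖ ^ 2 + ε ^ 2 ≠ 0 := fun ξ => by positivity
  have hΦ : ContDiff ℝ 1 Φ := ((contDiff_norm_hNormal_sq ν).add contDiff_const).rpow_const_of_ne hpos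
  have hΦN : ∀ ξ, inner ℝ (hNormal ν ξ) (hGrad n Φ ξ) = 0 := fun ξ => by
    rw [hGrad_comp (φ := fun x => (x + ε ^ 2) ^ r) (f := fun ζ => ‖hNormal ν ζ‖ ^ 2)
      (((hasDerivAt_id _).add_const _).rpow_const (Or.inl (hpos ξ)))
      ((contDiff_norm_hNormal_sq ν).differentiable one_ne_zero ξ), inner_smul_right,
      inner_hNormal_hGrad_norm_sq, mul_zero]
  have hk : ∀ k, ContDiff ℝ 1 fun ξ => Φ ξ * hNormal ν ξ k * f ξ := fun k =>
    (hΦ.mul (contDiff_hNormal_apply ν k)).mul hf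
  have hck : ∀ k, HasCompactSupport fun ξ => Φ ξ * hNormal ν ξ k * f ξ := fun k => hc.mul_left
  have h0 := Finset.sum_eq_zero fun k (_ : k ∈ Finset.univ) =>
    integral_fderiv_hFrame (hk k) (hck k) k
  rw [← integral_finsetSum] at h0
  · rw [← h0]
    congr! 2 with ξ
    have e : ∀ k, fderiv ℝ (fun ξ => Φ ξ * hNormal ν ξ k * f ξ) ξ (hFrame n k ξ) =
        Φ ξ * (hNormal ν ξ k * hGrad n f ξ k) + f ξ * (hNormal ν ξ k * hGrad n Φ ξ k) := by
      intro k
      have d1 := hΦ.differentiable one_ne_zero ξ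
      have d2 := (contDiff_hNormal_apply ν k).differentiable one_ne_zero ξ
      have d3 := hf.differentiable one_ne_zero ξ
      rw [fderiv_fun_mul (d1.fun_mul d2) d3, fderiv_fun_mul d1 d2]
      simp [fderiv_hNormal_hFrame_self]
      ring
    have hΦξ := hΦN ξ
    simp only [PiLp.inner_apply, RCLike.inner_apply, conj_trivial] at hΦξ ⊢
    simp only [e, Finset.sum_add_distrib, ← Finset.mul_sum]
    simp only [mul_comm (hNormal ν ξ _)]
    rw [hΦξ, mul_zero, add_zero]
  · intro k _
    have hcont : Continuous fun ξ => fderiv ℝ (fun ξ => Φ ξ * hNormal ν ξ k * f ξ) ξ (hFrame n k ξ) :=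
      ((hk k).continuous_fderiv one_ne_zero).clm_apply (continuous_hFrame k)
    refine hcont.integrable_of_hasCompactSupport ?_
    exact HasCompactSupport.intro (hck k) fun ξ hξ => by simp [fderiv_of_notMem_tsupport ℝ hξ]

theorem continuous_integral_of_compact_support {F : ℝ → H n → ℝ} {K : Set (H n)} (hK : IsCompact K)
    (hF : Continuous (Function.uncurry F)) (hz : ∀ ε, ∀ ξ ∉ K, F ε ξ = 0) :
    Continuous fun ε => ∫ ξ, F ε ξ :=
  continuousOn_univ.1 <| continuousOn_integral_of_compact_support hK hF.continuousOn
    fun ε ξ _ => hz ε ξ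

theorem integrable_of_compact_support {f : H n → ℝ} {K : Set (H n)} (hK : IsCompact K)
    (hf : Continuous f) (hz : ∀ ξ ∉ K, f ξ = 0) : Integrable f :=
  hf.integrable_of_hasCompactSupport (HasCompactSupport.intro hK hz)

theorem sq_rpow_half {x : ℝ} (r : ℝ) : (x ^ 2) ^ (r / 2) = |x| ^ r := by
  rw [← sq_abs, ← Real.rpow_natCast, ← Real.rpow_mul (abs_nonneg x)]
  congr 1; push_cast; ring

theorem integral_norm_rpow_mul_inner_hNormal (ν : H n) {f : H n → ℝ} (hf : ContDiff ℝ 1 f)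
    (hc : HasCompactSupport f) {r : ℝ} (hr : 0 ≤ r) :
    ∫ ξ, ‖hNormal ν ξ‖ ^ r * inner ℝ (hNormal ν ξ) (hGrad n f ξ) = 0 := by
  have hN := continuous_hNormal ν
  have hcont : Continuous fun ε : ℝ => ∫ ξ, (‖hNormal ν ξ‖ ^ 2 + ε ^ 2) ^ (r / 2) *
      inner ℝ (hNormal ν ξ) (hGrad n f ξ) := by
    refine continuous_integral_of_compact_support hc ?_ fun ε ξ hξ => by
      simp [hGrad_eq_zero hξ]
    have := continuous_hGrad hf
    refine Continuous.mul (Continuous.rpow_const (by fun_prop) fun _ => Or.inr (by linarith)) ?_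
    exact (hN.comp continuous_snd).inner (this.comp continuous_snd)
  have h1 := (hcont.tendsto 0).mono_left (nhdsWithin_le_nhds (s := {0}ᶜ))
  have h2 : Filter.Tendsto (fun ε : ℝ => ∫ ξ, (‖hNormal ν ξ‖ ^ 2 + ε ^ 2) ^ (r / 2) *
      inner ℝ (hNormal ν ξ) (hGrad n f ξ)) (nhdsWithin 0 {0}ᶜ) (nhds 0) := by
    refine tendsto_const_nhds.congr' ?_
    filter_upwards [self_mem_nhdsWithin] with ε hε
    exact (integral_mul_inner_hNormal ν hf hc _ hε).symm
  have h3 := tendsto_nhds_unique h1 h2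
  simpa [sq_rpow_half] using h3

/-- The `L¹` Sobolev inequality applied to `|u| ^ s`. -/
theorem sobolev_abs_rpow {c q : ℝ} (hq : 0 < q)
    (hSob : ∀ g : H n → ℝ, ContDiff ℝ (⊤ : ℕ∞) g → HasCompactSupport g →
      c * (∫ ξ : H n, |g ξ| ^ q) ^ (1 / q) ≤ ∫ ξ : H n, hNorm n g ξ)
    {u : H n → ℝ} (hu : ContDiff ℝ (⊤ : ℕ∞) u) (hc : HasCompactSupport u) {s : ℝ} (hs : 2 ≤ s) :
    c * (∫ ξ, |u ξ| ^ (s * q)) ^ (1 / q) ≤ s * ∫ ξ, |u ξ| ^ (s - 1) * ‖hGrad n u ξ‖ := by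
  set g : ℝ → H n → ℝ := fun ε ξ => (u ξ ^ 2 + ε ^ 2) ^ (s / 2) - (ε ^ 2) ^ (s / 2)
  set G : ℝ → H n → ℝ := fun ε ξ => s * (u ξ ^ 2 + ε ^ 2) ^ (s / 2 - 1) * |u ξ| * ‖hGrad n u ξ‖
  have hu0 : ∀ ξ ∉ tsupport u, u ξ = 0 := fun ξ hξ => image_eq_zero_of_notMem_tsupport hξ
  have hucont := hu.continuous
  have hgz : ∀ ε, ∀ ξ ∉ tsupport u, g ε ξ = 0 := fun ε ξ hξ => by simp [g, hu0 ξ hξ]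
  have hgc : Continuous (Function.uncurry g) :=
    (Continuous.rpow_const (by fun_prop) fun _ => Or.inr (by linarith)).sub
      (Continuous.rpow_const (by fun_prop) fun _ => Or.inr (by linarith))
  have hL : Continuous fun ε => c * (∫ ξ, |g ε ξ| ^ q) ^ (1 / q) := by
    refine continuous_const.mul (Continuous.rpow_const ?_ fun _ => Or.inr (by positivity))
    refine continuous_integral_of_compact_support hc
      (hgc.abs.rpow_const fun _ => Or.inr hq.le) fun ε ξ hξ => ?_
    simp [hgz ε ξ hξ, hq.ne']
  have hR : Continuous fun ε => ∫ ξ, G ε ξ := by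
    refine continuous_integral_of_compact_support hc ?_ fun ε ξ hξ => by
      simp [G, hu0 ξ hξ]
    have h1 : Continuous (hGrad n u) := continuous_hGrad (hu.of_le (by simp))
    refine ((continuous_const.mul (Continuous.rpow_const (by fun_prop)
      fun _ => Or.inr (by linarith))).mul (by fun_prop)).mul ?_
    exact (h1.comp continuous_snd).norm
  have hle : ∀ ε ∈ ({0}ᶜ : Set ℝ), c * (∫ ξ, |g ε ξ| ^ q) ^ (1 / q) ≤ ∫ ξ, G ε ξ := by
    intro ε hε
    have hε' : ε ≠ 0 := hε
    have hpos : ∀ ξ, u ξ ^ 2 + ε ^ 2 ≠ 0 := fun ξ => by positivity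
    have hgs : ContDiff ℝ (⊤ : ℕ∞) (g ε) :=
      (((hu.pow 2).add contDiff_const).rpow_const_of_ne hpos).sub contDiff_const
    refine (hSob (g ε) hgs (HasCompactSupport.intro hc (hgz ε))).trans_eq ?_
    congr! 2 with ξ
    have hd : HasDerivAt (fun x : ℝ => (x ^ 2 + ε ^ 2) ^ (s / 2) - (ε ^ 2) ^ (s / 2))
        (2 * u ξ * (s / 2) * (u ξ ^ 2 + ε ^ 2) ^ (s / 2 - 1)) (u ξ) := by
      have h1 : HasDerivAt (fun x : ℝ => x ^ 2 + ε ^ 2) (2 * u ξ) (u ξ) := by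
        simpa using (hasDerivAt_pow 2 (u ξ)).add_const (ε ^ 2)
      exact (h1.rpow_const (p := s / 2) (Or.inl (hpos ξ))).sub_const _
    rw [← norm_hGrad, hGrad_comp (φ := fun x : ℝ => (x ^ 2 + ε ^ 2) ^ (s / 2) - (ε ^ 2) ^ (s / 2))
      hd (hu.differentiable (by simp) ξ), norm_smul, Real.norm_eq_abs, abs_mul, abs_mul, abs_mul,
      abs_of_nonneg (show (0 : ℝ) ≤ 2 by norm_num), abs_of_nonneg (show (0 : ℝ) ≤ s / 2 by linarith),
      abs_of_nonneg (show 0 ≤ (u ξ ^ 2 + ε ^ 2) ^ (s / 2 - 1) by positivity)]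
    ring
  have hlim := le_of_tendsto_of_tendsto
    ((hL.tendsto 0).mono_left (nhdsWithin_le_nhds (s := {0}ᶜ)))
    ((hR.tendsto 0).mono_left nhdsWithin_le_nhds)
    (Filter.eventually_of_mem self_mem_nhdsWithin hle)
  rw [← integral_const_mul]
  have e1 : ∀ ξ, |g 0 ξ| ^ q = |u ξ| ^ (s * q) := fun ξ => by
    simp only [g, ne_eq, OfNat.ofNat_ne_zero, not_false_eq_true, zero_pow, add_zero, sq_rpow_half,
      abs_zero, Real.zero_rpow (show s ≠ 0 by linarith), sub_zero]
    rw [abs_of_nonneg (by positivity), ← Real.rpow_mul (abs_nonneg _)]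
  have e2 : ∀ ξ, G 0 ξ = s * (|u ξ| ^ (s - 1) * ‖hGrad n u ξ‖) := fun ξ => by
    simp only [G, ne_eq, OfNat.ofNat_ne_zero, not_false_eq_true, zero_pow, add_zero]
    rw [show s / 2 - 1 = (s - 2) / 2 by ring, sq_rpow_half, show s - 1 = s - 2 + 1 by ring,
      Real.rpow_add_one' (abs_nonneg _) (by linarith)]
    ring
  simpa only [e1, e2] using hlim

section GroundState

variable {ν : H n} {d p : ℝ} {u w : H n → ℝ}

/-- With `u = δ w = δ ^ ((p-1)/p) v`, this is `δ ^ ((p-1)/p) ∇_H v`. -/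
def hRemainder (ν : H n) (p : ℝ) (u w : H n → ℝ) (ξ : H n) :
    EuclideanSpace ℝ (Fin n ⊕ Fin n) :=
  hGrad n u ξ - ((p - 1) / p * w ξ) • hNormal ν ξ

theorem continuous_hRemainder (hu : ContDiff ℝ 1 u) (hw : Continuous w) :
    Continuous (hRemainder ν p u w) := by
  have := continuous_hGrad hu
  have := continuous_hNormal ν
  unfold hRemainder
  fun_prop

theorem hGrad_eq_hRemainder_add (ξ : H n) :
    hGrad n u ξ = hRemainder ν p u w ξ + ((p - 1) / p * w ξ) • hNormal ν ξ :=
  (sub_add_cancel _ _).symm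

theorem eq_zero_of_notMem (huw : ∀ ξ, u ξ = (iprod n ξ ν - d) * w ξ) {ξ : H n}
    (hξ : ξ ∉ tsupport w) : u ξ = 0 := by
  simp [huw, image_eq_zero_of_notMem_tsupport hξ]

theorem tsupport_subset_of_eq_mul (huw : ∀ ξ, u ξ = (iprod n ξ ν - d) * w ξ) :
    tsupport u ⊆ tsupport w := by
  rw [show u = fun ξ => (iprod n ξ ν - d) * w ξ from funext huw]
  exact closure_mono (Function.support_mul_subset_right _ _)

theorem hRemainder_eq_zero (huw : ∀ ξ, u ξ = (iprod n ξ ν - d) * w ξ) {ξ : H n}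
    (hξ : ξ ∉ tsupport w) : hRemainder ν p u w ξ = 0 := by
  simp [hRemainder, hGrad_eq_zero fun h => hξ (tsupport_subset_of_eq_mul huw h),
    image_eq_zero_of_notMem_tsupport hξ]

/-- Sharp Hardy inequality with remainder. -/
theorem hardy_remainder (hp : 2 ≤ p) (hw : ContDiff ℝ 1 w) (hc : HasCompactSupport w)
    (huw : ∀ ξ, u ξ = (iprod n ξ ν - d) * w ξ) :
    2 ^ (1 - p) * ∫ ξ, ‖hRemainder ν p u w ξ‖ ^ p ≤
      (∫ ξ, ‖hGrad n u ξ‖ ^ p) - ((p - 1) / p) ^ p * ∫ ξ, ‖hNormal ν ξ‖ ^ p * |w ξ| ^ p := by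
  have hp0 : 0 < p := by linarith
  set b := (p - 1) / p with hb
  have hb0 : 0 < b := div_pos (by linarith) hp0
  have hu : ContDiff ℝ 1 u := by
    rw [funext huw]; exact (contDiff_iprod_sub ν d).mul hw
  set f : H n → ℝ := fun ξ => |w ξ| ^ p * (iprod n ξ ν - d)
  have hwp : ContDiff ℝ 1 fun ξ => |w ξ| ^ p :=
    (contDiff_norm_rpow (E := ℝ) (p := p) (by linarith)).comp hw
  have hf : ContDiff ℝ 1 f := hwp.mul (contDiff_iprod_sub ν d)
  have hw0 : ∀ ξ ∉ tsupport w, w ξ = 0 := fun ξ hξ => image_eq_zero_of_notMem_tsupport hξ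
  have hfc : HasCompactSupport f := HasCompactSupport.intro hc fun ξ hξ => by
    simp [f, hw0 ξ hξ, hp0.ne']
  have hzero := integral_norm_rpow_mul_inner_hNormal ν hf hfc (r := p - 2) (by linarith)
  have hN := continuous_hNormal ν
  have hf0 : ∀ ξ ∉ tsupport w, hGrad n f ξ = 0 := fun ξ hξ => hGrad_eq_zero fun h => hξ <|
    closure_minimal (fun ζ hζ => by
      by_contra h'
      exact hζ (by simp [f, hw0 ζ h', hp0.ne'])) (isClosed_tsupport w) h
  have iA : Integrable fun ξ => ‖hNormal ν ξ‖ ^ p * |w ξ| ^ p := by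
    refine integrable_of_compact_support hc ?_ fun ξ hξ => by simp [hw0 ξ hξ, hp0.ne']
    exact (hN.norm.rpow_const fun _ => Or.inr hp0.le).mul hwp.continuous
  have iB : Integrable fun ξ => ‖hRemainder ν p u w ξ‖ ^ p := by
    refine integrable_of_compact_support hc ?_ fun ξ hξ => by
      simp [hRemainder_eq_zero huw hξ, hp0.ne']
    exact (continuous_hRemainder hu hw.continuous).norm.rpow_const fun _ => Or.inr hp0.le
  have iG : Integrable fun ξ => ‖hGrad n u ξ‖ ^ p := by
    refine integrable_of_compact_support hc ?_ fun ξ hξ => by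
      simp [hGrad_eq_zero fun h => hξ (tsupport_subset_of_eq_mul huw h), hp0.ne']
    exact (continuous_hGrad hu).norm.rpow_const fun _ => Or.inr hp0.le
  have iF : Integrable fun ξ => ‖hNormal ν ξ‖ ^ (p - 2) *
      inner ℝ (hNormal ν ξ) (hGrad n f ξ) := by
    refine integrable_of_compact_support hc ?_ fun ξ hξ => by simp [hf0 ξ hξ]
    exact (hN.norm.rpow_const fun _ => Or.inr (by linarith)).mul (hN.inner (continuous_hGrad hf))
  have hpt : ∀ ξ, b ^ p * (‖hNormal ν ξ‖ ^ p * |w ξ| ^ p) +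
      b ^ (p - 2) * b * (‖hNormal ν ξ‖ ^ (p - 2) * inner ℝ (hNormal ν ξ) (hGrad n f ξ)) +
      2 ^ (1 - p) * ‖hRemainder ν p u w ξ‖ ^ p ≤ ‖hGrad n u ξ‖ ^ p := by
    intro ξ
    have h := norm_rpow_add_inner_add_le ((b * w ξ) • hNormal ν ξ) (hRemainder ν p u w ξ) hp
    have eadd : (b * w ξ) • hNormal ν ξ + hRemainder ν p u w ξ = hGrad n u ξ := by
      rw [add_comm]; exact (hGrad_eq_hRemainder_add ξ).symm
    have dw := hw.differentiable one_ne_zero ξ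
    have dδ : DifferentiableAt ℝ (fun ζ => iprod n ζ ν - d) ξ :=
      (contDiff_iprod_sub ν d (m := 1)).differentiable one_ne_zero ξ
    have egu : hGrad n u ξ = (iprod n ξ ν - d) • hGrad n w ξ + w ξ • hNormal ν ξ := by
      rw [funext huw, hGrad_mul dδ dw, hGrad_iprod_sub]
    have egf : hGrad n f ξ = |w ξ| ^ p • hNormal ν ξ +
        (iprod n ξ ν - d) • (p * |w ξ| ^ (p - 2) * w ξ) • hGrad n w ξ := by
      rw [hGrad_mul (hwp.differentiable one_ne_zero ξ) dδ, hGrad_iprod_sub,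
        hGrad_comp (φ := fun x => |x| ^ p) (hasDerivAt_abs_rpow (w ξ) (by linarith)) dw]
    have eabs : |w ξ| ^ p = |w ξ| ^ (p - 2) * w ξ ^ 2 := by
      rw [← sq_abs, ← Real.rpow_natCast, ← Real.rpow_add' (abs_nonneg _)] <;> norm_num
      linarith
    have epb : p * (1 - b) = 1 := by rw [hb]; field_simp; ring
    have einner : p * (‖(b * w ξ) • hNormal ν ξ‖ ^ (p - 2) *
        inner ℝ ((b * w ξ) • hNormal ν ξ) (hRemainder ν p u w ξ)) =
        b ^ (p - 2) * b * (‖hNormal ν ξ‖ ^ (p - 2) * inner ℝ (hNormal ν ξ) (hGrad n f ξ)) := by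
      rw [hRemainder, egu, egf, norm_smul, Real.norm_eq_abs, abs_mul, abs_of_pos hb0,
        Real.mul_rpow (by positivity) (norm_nonneg _), Real.mul_rpow hb0.le (abs_nonneg _), eabs]
      simp only [inner_sub_right, inner_add_right, inner_smul_left, inner_smul_right,
        conj_trivial, ← hb]
      linear_combination (b ^ (p - 2) * |w ξ| ^ (p - 2) * ‖hNormal ν ξ‖ ^ (p - 2) * b * w ξ ^ 2 *
        inner ℝ (hNormal ν ξ) (hNormal ν ξ)) * epb
    rw [eadd, einner, norm_smul, Real.norm_eq_abs, abs_mul, abs_of_pos hb0,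
      Real.mul_rpow (by positivity) (norm_nonneg _), Real.mul_rpow hb0.le (abs_nonneg _)] at h
    linarith
  have iAF : Integrable fun ξ => b ^ p * (‖hNormal ν ξ‖ ^ p * |w ξ| ^ p) +
      b ^ (p - 2) * b * (‖hNormal ν ξ‖ ^ (p - 2) * inner ℝ (hNormal ν ξ) (hGrad n f ξ)) :=
    (iA.const_mul _).add (iF.const_mul _)
  have hint := integral_mono (iAF.add (iB.const_mul (2 ^ (1 - p)))) iG hpt
  rw [integral_add' iAF (iB.const_mul _), integral_add (iA.const_mul _) (iF.const_mul _),
    integral_const_mul, integral_const_mul, integral_const_mul, hzero] at hint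
  linarith

theorem inv_sqrt_weight_bounds {W ε : ℝ} (hε : 0 < ε) :
    0 ≤ (W ^ 2 + ε ^ 2) ^ (-(1 / 2) : ℝ) ∧ (W ^ 2 + ε ^ 2) ^ (-(1 / 2) : ℝ) * W ≤ 1 ∧
      W - ε ≤ (W ^ 2 + ε ^ 2) ^ (-(1 / 2) : ℝ) * W ^ 2 := by
  have hpos : 0 < W ^ 2 + ε ^ 2 := by positivity
  rw [Real.rpow_neg hpos.le, ← Real.sqrt_eq_rpow]
  set S := √(W ^ 2 + ε ^ 2)
  have hS : 0 < S := Real.sqrt_pos.2 hpos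
  have hS2 : S ^ 2 = W ^ 2 + ε ^ 2 := Real.sq_sqrt hpos.le
  have hWS : W ≤ S := Real.le_sqrt_of_sq_le (by nlinarith)
  have hεS : ε ≤ S := Real.le_sqrt_of_sq_le (by nlinarith)
  refine ⟨by positivity, ?_, ?_⟩
  · rw [inv_mul_le_iff₀ hS]; linarith
  · rw [le_inv_mul_iff₀ hS]; nlinarith

theorem integral_abs_rpow_mul_norm_hNormal_le (hp : 2 ≤ p) (hw : ContDiff ℝ 1 w)
    (hc : HasCompactSupport w) (huw : ∀ ξ, u ξ = (iprod n ξ ν - d) * w ξ)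
    (hsign : ∀ ξ, w ξ ≠ 0 → 0 ≤ iprod n ξ ν - d) {s : ℝ} (hs : 2 ≤ s) :
    (p - 1) / p * ∫ ξ, |u ξ| ^ (s - 1) * |w ξ| * ‖hNormal ν ξ‖ ≤
      ∫ ξ, |u ξ| ^ (s - 1) * ‖hRemainder ν p u w ξ‖ := by
  set b := (p - 1) / p with hb
  have hb0 : 0 < b := div_pos (by linarith) (by linarith)
  have hu : ContDiff ℝ 1 u := by
    rw [funext huw]; exact (contDiff_iprod_sub ν d).mul hw
  have hu0 : ∀ ξ ∉ tsupport w, u ξ = 0 := fun ξ hξ => eq_zero_of_notMem huw hξ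
  have hs1 : s - 1 ≠ 0 := by linarith
  set f : H n → ℝ := fun ξ => |u ξ| ^ s
  have hf : ContDiff ℝ 1 f := (contDiff_norm_rpow (E := ℝ) (p := s) (by linarith)).comp hu
  have hfc : HasCompactSupport f := HasCompactSupport.intro hc fun ξ hξ => by
    simp [f, hu0 ξ hξ, show s ≠ 0 by linarith]
  have hf0 : ∀ ξ ∉ tsupport w, hGrad n f ξ = 0 := fun ξ hξ => hGrad_eq_zero fun h => hξ <|
    closure_minimal (fun ζ hζ => by
      by_contra h'
      exact hζ (by simp [f, hu0 ζ h', show s ≠ 0 by linarith])) (isClosed_tsupport w) h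
  have hN := continuous_hNormal ν
  have hwc := hw.continuous
  have hus : Continuous fun ξ => |u ξ| ^ (s - 1) :=
    hu.continuous.abs.rpow_const fun _ => Or.inr (by linarith)
  have iW : Integrable fun ξ => |u ξ| ^ (s - 1) * |w ξ| * ‖hNormal ν ξ‖ :=
    integrable_of_compact_support hc (by fun_prop) fun ξ hξ => by simp [hu0 ξ hξ, hs1]
  have iw : Integrable fun ξ => |u ξ| ^ (s - 1) * |w ξ| :=
    integrable_of_compact_support hc (by fun_prop) fun ξ hξ => by simp [hu0 ξ hξ, hs1]
  have iB : Integrable fun ξ => |u ξ| ^ (s - 1) * ‖hRemainder ν p u w ξ‖ := by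
    have := continuous_hRemainder (ν := ν) (p := p) hu hwc
    exact integrable_of_compact_support hc (by fun_prop) fun ξ hξ => by simp [hu0 ξ hξ, hs1]
  have key : ∀ ε > 0, b * ∫ ξ, |u ξ| ^ (s - 1) * |w ξ| * ‖hNormal ν ξ‖ ≤
      (∫ ξ, |u ξ| ^ (s - 1) * ‖hRemainder ν p u w ξ‖) +
        ε * (b * ∫ ξ, |u ξ| ^ (s - 1) * |w ξ|) := by
    intro ε hε
    have hzero := integral_mul_inner_hNormal ν hf hfc (-(1 / 2)) hε.ne'
    have iF : Integrable fun ξ => (‖hNormal ν ξ‖ ^ 2 + ε ^ 2) ^ (-(1 / 2) : ℝ) *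
        inner ℝ (hNormal ν ξ) (hGrad n f ξ) := by
      refine integrable_of_compact_support hc ?_ fun ξ hξ => by simp [hf0 ξ hξ]
      exact (Continuous.rpow_const (by fun_prop) fun ξ => Or.inl (by positivity)).mul
        (hN.inner (continuous_hGrad hf))
    have hpt : ∀ ξ, b * (|u ξ| ^ (s - 1) * |w ξ| * ‖hNormal ν ξ‖) ≤
        |u ξ| ^ (s - 1) * ‖hRemainder ν p u w ξ‖ + (ε * b) * (|u ξ| ^ (s - 1) * |w ξ|) +
        s⁻¹ * ((‖hNormal ν ξ‖ ^ 2 + ε ^ 2) ^ (-(1 / 2) : ℝ) *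
          inner ℝ (hNormal ν ξ) (hGrad n f ξ)) := by
      intro ξ
      obtain ⟨h0, h1, h2⟩ := inv_sqrt_weight_bounds (W := ‖hNormal ν ξ‖) hε
      set ψ := (‖hNormal ν ξ‖ ^ 2 + ε ^ 2) ^ (-(1 / 2) : ℝ)
      have egf : hGrad n f ξ = (s * |u ξ| ^ (s - 2) * u ξ) • hGrad n u ξ :=
        hGrad_comp (φ := fun x => |x| ^ s) (hasDerivAt_abs_rpow (u ξ) (by linarith))
          (hu.differentiable one_ne_zero ξ)
      have euw : u ξ * w ξ = |u ξ| * |w ξ| := by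
        rcases eq_or_ne (w ξ) 0 with h | h
        · simp [h]
        · rw [huw, abs_mul, abs_of_nonneg (hsign ξ h), mul_assoc, mul_assoc, abs_mul_abs_self]
      have ers : |u ξ| ^ (s - 1) = |u ξ| ^ (s - 2) * |u ξ| := by
        rw [← Real.rpow_add_one' (abs_nonneg _) (by linarith)]; ring_nf
      have einner : s⁻¹ * (ψ * inner ℝ (hNormal ν ξ) (hGrad n f ξ)) =
          |u ξ| ^ (s - 2) * (ψ * (u ξ * inner ℝ (hNormal ν ξ) (hRemainder ν p u w ξ))) +
          b * (|u ξ| ^ (s - 1) * |w ξ|) * (ψ * ‖hNormal ν ξ‖ ^ 2) := by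
        rw [egf, hGrad_eq_hRemainder_add (ν := ν) (p := p) (w := w), inner_smul_right,
          inner_add_right, inner_smul_right, real_inner_self_eq_norm_sq, ers, ← hb]
        have hss : s⁻¹ * s = 1 := inv_mul_cancel₀ (by linarith)
        linear_combination (ψ * |u ξ| ^ (s - 2) * ‖hNormal ν ξ‖ ^ 2 * b) * euw +
          (ψ * |u ξ| ^ (s - 2) * u ξ * (inner ℝ (hNormal ν ξ) (hRemainder ν p u w ξ) +
            b * w ξ * ‖hNormal ν ξ‖ ^ 2)) * hss
      have hB : -(|u ξ| ^ (s - 1) * ‖hRemainder ν p u w ξ‖) ≤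
          |u ξ| ^ (s - 2) * (ψ * (u ξ * inner ℝ (hNormal ν ξ) (hRemainder ν p u w ξ))) := by
        refine neg_le_of_abs_le ?_
        rw [abs_mul, abs_mul, abs_mul, abs_of_nonneg h0, abs_of_nonneg (by positivity), ers]
        calc _ ≤ |u ξ| ^ (s - 2) * (ψ * (|u ξ| * (‖hNormal ν ξ‖ * ‖hRemainder ν p u w ξ‖))) := by
              gcongr; exact abs_real_inner_le_norm _ _
          _ = |u ξ| ^ (s - 2) * |u ξ| * ‖hRemainder ν p u w ξ‖ * (ψ * ‖hNormal ν ξ‖) := by ring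
          _ ≤ |u ξ| ^ (s - 2) * |u ξ| * ‖hRemainder ν p u w ξ‖ * 1 := by gcongr
          _ = _ := by ring
      have hψ := mul_le_mul_of_nonneg_left h2
        (show 0 ≤ b * (|u ξ| ^ (s - 1) * |w ξ|) by positivity)
      rw [einner]
      linarith
    have iBw : Integrable fun ξ => |u ξ| ^ (s - 1) * ‖hRemainder ν p u w ξ‖ +
        (ε * b) * (|u ξ| ^ (s - 1) * |w ξ|) := iB.add (iw.const_mul _)
    have hint := integral_mono (iW.const_mul b) (iBw.add (iF.const_mul s⁻¹)) hpt
    rw [integral_add' iBw (iF.const_mul _), integral_add iB (iw.const_mul _), integral_const_mul,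
      integral_const_mul, integral_const_mul, hzero] at hint
    linarith
  have hlim : Filter.Tendsto (fun ε : ℝ => (∫ ξ, |u ξ| ^ (s - 1) * ‖hRemainder ν p u w ξ‖) +
      ε * (b * ∫ ξ, |u ξ| ^ (s - 1) * |w ξ|)) (nhdsWithin 0 (Set.Ioi 0))
      (nhds ((∫ ξ, |u ξ| ^ (s - 1) * ‖hRemainder ν p u w ξ‖) +
        0 * (b * ∫ ξ, |u ξ| ^ (s - 1) * |w ξ|))) :=
    ((continuous_const.add (continuous_id.mul continuous_const)).tendsto 0).mono_left
      nhdsWithin_le_nhds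
  simpa using ge_of_tendsto hlim (Filter.eventually_of_mem self_mem_nhdsWithin key)

theorem integral_abs_rpow_mul_norm_hGrad_le (hp : 2 ≤ p) (hw : ContDiff ℝ 1 w)
    (hc : HasCompactSupport w) (huw : ∀ ξ, u ξ = (iprod n ξ ν - d) * w ξ)
    (hsign : ∀ ξ, w ξ ≠ 0 → 0 ≤ iprod n ξ ν - d) {s : ℝ} (hs : 2 ≤ s) :
    ∫ ξ, |u ξ| ^ (s - 1) * ‖hGrad n u ξ‖ ≤
      2 * ∫ ξ, |u ξ| ^ (s - 1) * ‖hRemainder ν p u w ξ‖ := by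
  have hb0 : 0 < (p - 1) / p := div_pos (by linarith) (by linarith)
  have hu : ContDiff ℝ 1 u := by
    rw [funext huw]; exact (contDiff_iprod_sub ν d).mul hw
  have hu0 : ∀ ξ ∉ tsupport w, u ξ = 0 := fun ξ hξ => eq_zero_of_notMem huw hξ
  have hs1 : s - 1 ≠ 0 := by linarith
  have hN := continuous_hNormal ν
  have hwc := hw.continuous
  have hG := continuous_hGrad hu
  have hB := continuous_hRemainder (ν := ν) (p := p) hu hwc
  have hus : Continuous fun ξ => |u ξ| ^ (s - 1) :=
    hu.continuous.abs.rpow_const fun _ => Or.inr (by linarith)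
  have iG : Integrable fun ξ => |u ξ| ^ (s - 1) * ‖hGrad n u ξ‖ :=
    integrable_of_compact_support hc (by fun_prop) fun ξ hξ => by simp [hu0 ξ hξ, hs1]
  have iW : Integrable fun ξ => |u ξ| ^ (s - 1) * |w ξ| * ‖hNormal ν ξ‖ :=
    integrable_of_compact_support hc (by fun_prop) fun ξ hξ => by simp [hu0 ξ hξ, hs1]
  have iB : Integrable fun ξ => |u ξ| ^ (s - 1) * ‖hRemainder ν p u w ξ‖ :=
    integrable_of_compact_support hc (by fun_prop) fun ξ hξ => by simp [hu0 ξ hξ, hs1]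
  have hint := integral_mono iG (iB.add (iW.const_mul ((p - 1) / p))) fun ξ => by
    simp only [Pi.add_apply]
    rw [hGrad_eq_hRemainder_add (ν := ν) (p := p) (w := w)]
    calc _ ≤ |u ξ| ^ (s - 1) * (‖hRemainder ν p u w ξ‖ + ‖((p - 1) / p * w ξ) • hNormal ν ξ‖) := by
          gcongr; exact norm_add_le _ _
      _ = _ := by
          rw [norm_smul, Real.norm_eq_abs, abs_mul, abs_of_pos hb0]; ring
  rw [integral_add' iB (iW.const_mul _), integral_const_mul] at hint
  linarith [integral_abs_rpow_mul_norm_hNormal_le hp hw hc huw hsign hs]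

theorem integral_abs_rpow_mul_norm_hRemainder_le (hp : 2 ≤ p) (hw : ContDiff ℝ 1 w)
    (hc : HasCompactSupport w) (huw : ∀ ξ, u ξ = (iprod n ξ ν - d) * w ξ) {s : ℝ} (hs : 2 ≤ s) :
    ∫ ξ, |u ξ| ^ (s - 1) * ‖hRemainder ν p u w ξ‖ ≤
      (∫ ξ, ‖hRemainder ν p u w ξ‖ ^ p) ^ (1 / p) *
        (∫ ξ, |u ξ| ^ ((s - 1) * (p / (p - 1)))) ^ ((p - 1) / p) := by
  have hu : ContDiff ℝ 1 u := by
    rw [funext huw]; exact (contDiff_iprod_sub ν d).mul hw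
  have hB := continuous_hRemainder (ν := ν) (p := p) hu hw.continuous
  have hus : Continuous fun ξ => |u ξ| ^ (s - 1) :=
    hu.continuous.abs.rpow_const fun _ => Or.inr (by linarith)
  have h := integral_mul_le_Lp_mul_Lq_of_nonneg (μ := (volume : Measure (H n)))
    (Real.HolderConjugate.conjExponent (p := p) (by linarith))
    (f := fun ξ => ‖hRemainder ν p u w ξ‖) (g := fun ξ => |u ξ| ^ (s - 1))
    (Filter.Eventually.of_forall fun ξ => norm_nonneg _)
    (Filter.Eventually.of_forall fun ξ => Real.rpow_nonneg (abs_nonneg _) _)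
    (hB.norm.memLp_of_hasCompactSupport <| HasCompactSupport.intro hc fun ξ hξ => by
      simp [hRemainder_eq_zero huw hξ])
    (hus.memLp_of_hasCompactSupport <| HasCompactSupport.intro hc fun ξ hξ => by
      simp [eq_zero_of_notMem huw hξ, show s - 1 ≠ 0 by linarith])
  simpa only [Real.conjExponent, one_div_div, ← Real.rpow_mul (abs_nonneg _), mul_comm] using h

end GroundState

end HorizontalGradient

theorem geometric_hardy_sobolev (n : ℕ) (ν : H n) (hν : iprod n ν ν = 1) (d : ℝ)
    (p : ℝ) (hp2 : 2 ≤ p) (hpQ : p < 2 * n + 2)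
    (c : ℝ) (hc : 0 < c)
    (hSob : ∀ g : H n → ℝ, ContDiff ℝ (⊤ : ℕ∞) g → HasCompactSupport g →
      c * (∫ ξ : H n, |g ξ| ^ ((2 * n + 2 : ℝ) / (2 * n + 1 : ℝ))) ^
            ((2 * n + 1 : ℝ) / (2 * n + 2 : ℝ)) ≤
        ∫ ξ : H n, hNorm n g ξ) :
    ∃ C > 0, ∀ u : H n → ℝ, ContDiff ℝ (⊤ : ℕ∞) u → HasCompactSupport u →
      tsupport u ⊆ {ξ : H n | d < iprod n ξ ν} →
      ((∫ ξ in {ξ : H n | d < iprod n ξ ν}, hNorm n u ξ ^ p) -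
          ((p - 1) / p) ^ p *
            ∫ ξ in {ξ : H n | d < iprod n ξ ν},
              hNorm n (fun ζ => iprod n ζ ν - d) ξ ^ p / (iprod n ξ ν - d) ^ p
                * |u ξ| ^ p) ^ (1 / p) ≥
        C * (∫ ξ in {ξ : H n | d < iprod n ξ ν},
              |u ξ| ^ ((2 * n + 2 : ℝ) * p / ((2 * n + 2 : ℝ) - p))) ^
            (((2 * n + 2 : ℝ) - p) / ((2 * n + 2 : ℝ) * p)) := by
  have hQp : 0 < (2 * n + 2 : ℝ) - p := by linarith
  have hp0 : 0 < p := by linarith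
  have hn : (0 : ℝ) ≤ n := Nat.cast_nonneg n
  set Q : ℝ := 2 * n + 2 with hQ
  have hQ1 : (2 * n + 1 : ℝ) = Q - 1 := by rw [hQ]; ring
  rw [hQ1] at hSob
  have hQ1pos : 0 < Q - 1 := by linarith
  set s : ℝ := p * (Q - 1) / (Q - p) with hsdef
  have hs : 2 ≤ s := by
    rw [hsdef, le_div_iff₀ hQp]; nlinarith
  have hs0 : 0 < s := by linarith
  refine ⟨c / (2 * s) * (2 ^ (1 - p)) ^ (1 / p), by positivity, fun u hu hc hsupp => ?_⟩
  set S : Set (H n) := {ξ : H n | d < iprod n ξ ν}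
  set w : H n → ℝ := fun ξ => u ξ / (iprod n ξ ν - d)
  have hu0 : ∀ ξ ∉ S, u ξ = 0 := fun ξ hξ => image_eq_zero_of_notMem_tsupport fun h => hξ (hsupp h)
  have hw : ContDiff ℝ 1 w := contDiff_iff_contDiffAt.2 fun ξ => by
    by_cases h : ξ ∈ tsupport u
    · exact (hu.of_le (by simp)).contDiffAt.div (contDiff_iprod_sub ν d).contDiffAt
        (sub_pos.2 (hsupp h)).ne'
    · refine (contDiffAt_const (c := (0 : ℝ))).congr_of_eventuallyEq ?_
      filter_upwards [notMem_tsupport_iff_eventuallyEq.1 h] with ζ hζ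
      simp [w, hζ]
  have hwc : HasCompactSupport w := HasCompactSupport.intro hc fun ξ hξ => by
    simp [w, image_eq_zero_of_notMem_tsupport hξ]
  have huw : ∀ ξ, u ξ = (iprod n ξ ν - d) * w ξ := fun ξ => by
    by_cases h : ξ ∈ S
    · exact (mul_div_cancel₀ _ (sub_pos.2 h).ne').symm
    · simp [w, hu0 ξ h]
  have hsign : ∀ ξ, w ξ ≠ 0 → 0 ≤ iprod n ξ ν - d := fun ξ h => by
    by_contra h'
    exact h (by simp [w, hu0 ξ fun hS : d < iprod n ξ ν => h' (sub_nonneg.2 hS.le)])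
  have hhardy := hardy_remainder hp2 hw hwc huw
  have hpstar : Q * p / (Q - p) ≠ 0 := by positivity
  have e1 : ∫ ξ in S, hNorm n u ξ ^ p = ∫ ξ, ‖hGrad n u ξ‖ ^ p := by
    simp only [← norm_hGrad]
    refine setIntegral_eq_integral_of_forall_compl_eq_zero fun ξ hξ => ?_
    simp [hGrad_eq_zero fun h => hξ (hsupp h), hp0.ne']
  have e2 : ∫ ξ in S, hNorm n (fun ζ => iprod n ζ ν - d) ξ ^ p / (iprod n ξ ν - d) ^ p * |u ξ| ^ p =
      ∫ ξ, ‖hNormal ν ξ‖ ^ p * |w ξ| ^ p := by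
    trans ∫ ξ in S, ‖hNormal ν ξ‖ ^ p * |w ξ| ^ p
    · refine setIntegral_congr_fun ?_ fun ξ hξ => ?_
      · exact measurableSet_lt measurable_const (by unfold iprod; fun_prop)
      · have hδ : 0 < iprod n ξ ν - d := sub_pos.2 hξ
        simp only [w]
        rw [← norm_hGrad, hGrad_iprod_sub, abs_div, abs_of_pos hδ,
          Real.div_rpow (abs_nonneg _) hδ.le]
        ring
    · refine setIntegral_eq_integral_of_forall_compl_eq_zero fun ξ hξ => ?_
      simp [w, hu0 ξ hξ, hp0.ne']
  have e3 : ∫ ξ in S, |u ξ| ^ (Q * p / (Q - p)) = ∫ ξ, |u ξ| ^ (Q * p / (Q - p)) :=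
    setIntegral_eq_integral_of_forall_compl_eq_zero fun ξ hξ => by simp [hu0 ξ hξ, hpstar]
  rw [e1, e2, e3]
  have hsob := sobolev_abs_rpow (c := c) (q := Q / (Q - 1)) (by positivity)
    (by simpa only [one_div_div] using hSob) hu hc hs
  have hgrad := integral_abs_rpow_mul_norm_hGrad_le hp2 hw hwc huw hsign hs
  have hholder := integral_abs_rpow_mul_norm_hRemainder_le hp2 hw hwc huw hs
  have ex1 : s * (Q / (Q - 1)) = Q * p / (Q - p) := by rw [hsdef]; field_simp
  have ex2 : (s - 1) * (p / (p - 1)) = Q * p / (Q - p) := by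
    have : p - 1 ≠ 0 := by linarith
    rw [hsdef]; field_simp; ring
  rw [ex1, one_div_div] at hsob
  rw [ex2] at hholder
  set T := ∫ ξ, |u ξ| ^ (Q * p / (Q - p))
  set D := ∫ ξ, ‖hRemainder ν p u w ξ‖ ^ p
  have hD : 0 ≤ D := integral_nonneg fun ξ => by positivity
  have hT : 0 ≤ T := integral_nonneg fun ξ => by positivity
  have hexp : 0 < (Q - p) / (Q * p) := by positivity
  have hTD : c * T ^ ((Q - p) / (Q * p)) ≤ 2 * s * D ^ (1 / p) := by
    rcases hT.eq_or_lt with h | h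
    · rw [← h, Real.zero_rpow hexp.ne', mul_zero]; positivity
    · have ex3 : (Q - 1) / Q = (Q - p) / (Q * p) + (p - 1) / p := by
        have hQ0 : Q ≠ 0 := by linarith
        field_simp; ring
      rw [ex3, Real.rpow_add h] at hsob
      refine le_of_mul_le_mul_right ?_ (Real.rpow_pos_of_pos h ((p - 1) / p))
      calc _ = c * (T ^ ((Q - p) / (Q * p)) * T ^ ((p - 1) / p)) := by ring
        _ ≤ _ := hsob
        _ ≤ s * (2 * (D ^ (1 / p) * T ^ ((p - 1) / p))) := by gcongr; linarith
        _ = _ := by ring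
  calc c / (2 * s) * (2 ^ (1 - p)) ^ (1 / p) * T ^ ((Q - p) / (Q * p))
      = (2 ^ (1 - p)) ^ (1 / p) * (c * T ^ ((Q - p) / (Q * p)) / (2 * s)) := by ring
    _ ≤ (2 ^ (1 - p)) ^ (1 / p) * D ^ (1 / p) := by
        gcongr
        rw [div_le_iff₀ (by positivity)]
        linarith
    _ = (2 ^ (1 - p) * D) ^ (1 / p) := (Real.mul_rpow (by positivity) hD).symm
    _ ≤ _ := Real.rpow_le_rpow (by positivity) hhardy (by positivity)
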